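/- (Lemma 3.2) If a topologically mixing random countable topological Markov chain (X,T) has the b.i.p.-property, then for every a ∈ W^1 and almost every ω ∈ Ω_a there exist α_ω, β_ω ∈ ℕ such that: (i) W^n_ω(a,b) ≠ ∅ for all n ≥ α_ω and all b ∈ W^1_{θ^nω}; (ii) W^n_{θ^{−n}ω}(b,a) ≠ ∅ for all n ≥ β_ω and all b ∈ W^1_{θ^{−n}ω}. -/

import Mathlib

open MeasureTheory Filter Topology
open scoped Classical

noncomputable section

namespace RandomTMC

/-- A random countable topological Markov chain over an invertible base
transformation `θ` of `Ω`.  The alphabet availability `letterOK ω i` plays the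
role of "`i < ℓ_ω`", and `tr ω i j` is the 0–1 transition matrix `α_{ij}(ω)`. -/
structure Chain (Ω : Type*) [MeasurableSpace Ω] where
  θ : Ω → Ω
  θinv : Ω → Ω
  θ_meas : Measurable θ
  θinv_meas : Measurable θinv
  θ_left_inv : Function.LeftInverse θinv θ
  θ_right_inv : Function.RightInverse θinv θ
  letterOK : Ω → ℕ → Bool
  letterOK_meas : ∀ i, Measurable fun ω => letterOK ω i
  two_letters : ∀ ω, ∃ i j, i ≠ j ∧ letterOK ω i = true ∧ letterOK ω j = true
  tr : Ω → ℕ → ℕ → Bool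
  tr_meas : ∀ i j, Measurable fun ω => tr ω i j
  no_zero_row : ∀ ω i, letterOK ω i = true → ∃ j, letterOK (θ ω) j = true ∧ tr ω i j = true

variable {Ω : Type*} [MeasurableSpace Ω]

/-- The fiber `X_ω ⊆ ℕ^ℕ`. -/
def fiber (S : Chain Ω) (ω : Ω) : Set (ℕ → ℕ) :=
  {x | ∀ n : ℕ, S.letterOK (S.θ^[n] ω) (x n) = true ∧ S.tr (S.θ^[n] ω) (x n) (x (n + 1)) = true}

/-- The shift map `T_ω`. -/
def shift (x : ℕ → ℕ) : ℕ → ℕ := fun n => x (n + 1)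

/-- The iterated shift `T^n_ω`. -/
def shiftIt (n : ℕ) (x : ℕ → ℕ) : ℕ → ℕ := fun k => x (k + n)

/-- `w` is an `ω`-admissible word. -/
def wordAdm (S : Chain Ω) (ω : Ω) (w : List ℕ) : Prop :=
  (∀ (i : ℕ) (h : i < w.length), S.letterOK (S.θ^[i] ω) (w.get ⟨i, h⟩) = true) ∧
  (∀ (i : ℕ) (h : i + 1 < w.length),
    S.tr (S.θ^[i] ω) (w.get ⟨i, Nat.lt_of_succ_lt h⟩) (w.get ⟨i + 1, h⟩) = true)

/-- The cylinder set `[w]_ω`. -/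
def cyl (S : Chain Ω) (ω : Ω) (w : List ℕ) : Set (ℕ → ℕ) :=
  {x | x ∈ fiber S ω ∧ ∀ (i : ℕ) (h : i < w.length), x i = w.get ⟨i, h⟩}

/-- `Ω_w = {ω : [w]_ω ≠ ∅}`. -/
def OmegaW (S : Chain Ω) (w : List ℕ) : Set Ω := {ω | (cyl S ω w).Nonempty}

/-- The Birkhoff sum `φ^ω_n(x)`. -/
def birk (S : Chain Ω) (φ : Ω → (ℕ → ℕ) → ℝ) (ω : Ω) (n : ℕ) (x : ℕ → ℕ) : ℝ :=
  ∑ j ∈ Finset.range n, φ (S.θ^[j] ω) (shiftIt j x)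

/-- Prepend a finite word to a sequence. -/
def prepend (w : List ℕ) (x : ℕ → ℕ) : ℕ → ℕ := fun n =>
  if h : n < w.length then w.get ⟨n, h⟩ else x (n - w.length)

/-- The iterated Ruelle transfer operator `L^{ω,n}_φ f (x)`. -/
def ruelleIt (S : Chain Ω) (φ : Ω → (ℕ → ℕ) → ℝ) (ω : Ω) (n : ℕ)
    (f : (ℕ → ℕ) → ℝ) (x : ℕ → ℕ) : ℝ :=
  ∑' w : List ℕ,
    if w.length = n ∧ prepend w x ∈ fiber S ω then
      Real.exp (birk S φ ω n (prepend w x)) * f (prepend w x)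
    else 0

/-- `M_ω = sup L^ω_φ(1)`. -/
def Mfun (S : Chain Ω) (φ : Ω → (ℕ → ℕ) → ℝ) (ω : Ω) : ℝ :=
  sSup ((fun x => ruelleIt S φ ω 1 (fun _ => (1 : ℝ)) x) '' fiber S (S.θ ω))

/-- `m_ω = inf L^ω_φ(1)`. -/
def mfun (S : Chain Ω) (φ : Ω → (ℕ → ℕ) → ℝ) (ω : Ω) : ℝ :=
  sInf ((fun x => ruelleIt S φ ω 1 (fun _ => (1 : ℝ)) x) '' fiber S (S.θ ω))

/-- `B_ω = exp (∑_{k ≥ 1} κ(θ^{-k} ω) r^k)`. -/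
def Bconst (S : Chain Ω) (κ : Ω → ℝ) (r : ℝ) (ω : Ω) : ℝ :=
  Real.exp (∑' k : ℕ, κ (S.θinv^[k + 1] ω) * r ^ (k + 1))

/-- `φ` is locally fiber Hölder continuous with index `k`, constants `κ, r`. -/
def HolderIdx (S : Chain Ω) (P : Measure Ω) (φ : Ω → (ℕ → ℕ) → ℝ)
    (κ : Ω → ℝ) (r : ℝ) (k : ℕ) : Prop :=
  0 < r ∧ r < 1 ∧ (∀ ω, 1 ≤ κ ω) ∧ Measurable κ ∧
    Integrable (fun ω => Real.log (κ ω)) P ∧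
    ∀ ω (n : ℕ), k ≤ n → ∀ x ∈ fiber S ω, ∀ y ∈ fiber S ω,
      (∀ i < n, x i = y i) → |φ ω x - φ ω y| ≤ κ ω * r ^ n

/-- `exp(φ^ω_n([w])) = sup {exp(φ^ω_n(x)) : x ∈ [w]_ω}`. -/
def supExp (S : Chain Ω) (φ : Ω → (ℕ → ℕ) → ℝ) (ω : Ω) (n : ℕ) (w : List ℕ) : ℝ :=
  sSup ((fun x => Real.exp (birk S φ ω n x)) '' cyl S ω w)

/-- The Gurevič partition function `Z^ω_n(a)`. -/
def Zfun (S : Chain Ω) (φ : Ω → (ℕ → ℕ) → ℝ) (a : ℕ) (ω : Ω) (n : ℕ) : ℝ :=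
  ∑' w : List ℕ,
    if w.length = n ∧ w.head? = some a ∧ wordAdm S ω (w ++ [a]) then
      supExp S φ ω n (w ++ [a])
    else 0

/-- `A^ω_n = ∑_{w ∈ W^n_ω} e^{φ^ω_n([w])}`. -/
def Afun (S : Chain Ω) (φ : Ω → (ℕ → ℕ) → ℝ) (ω : Ω) (n : ℕ) : ℝ :=
  ∑' w : List ℕ, if w.length = n ∧ wordAdm S ω w then supExp S φ ω n w else 0

/-- The local preimage function `𝒵^ω_n(a) = L^{ω,n}_φ(1_{[a]})(ξ_{θ^n ω})`. -/
def locPre (S : Chain Ω) (φ : Ω → (ℕ → ℕ) → ℝ) (a : ℕ) (ξ : Ω → ℕ → ℕ) (ω : Ω) (n : ℕ) : ℝ :=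
  ruelleIt S φ ω n (Set.indicator (cyl S ω [a]) fun _ => (1 : ℝ)) (ξ (S.θ^[n] ω))

/-- The preimage function `𝒵^ω_n = L^{ω,n}_φ(1)(ξ_{θ^n ω})`. -/
def preFun (S : Chain Ω) (φ : Ω → (ℕ → ℕ) → ℝ) (ξ : Ω → ℕ → ℕ) (ω : Ω) (n : ℕ) : ℝ :=
  ruelleIt S φ ω n (fun _ => (1 : ℝ)) (ξ (S.θ^[n] ω))

/-- The mixing property for the pair `(a, b)` with mixing time `N = N_{ab}`. -/
def MixPair (S : Chain Ω) (a b : ℕ) (N : Ω → ℕ) : Prop :=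
  ∀ ω (n : ℕ), N ω ≤ n → wordAdm S ω [a] → S.θ^[n] ω ∈ OmegaW S [b] →
    ∃ x ∈ cyl S ω [a], shiftIt n x ∈ cyl S (S.θ^[n] ω) [b]

/-- `(X, T)` is topologically mixing. -/
def TopMix (S : Chain Ω) (P : Measure Ω) : Prop :=
  ∀ a b : ℕ, 0 < P (OmegaW S [a]) → 0 < P (OmegaW S [b]) →
    ∃ N : Ω → ℕ, Measurable N ∧ MixPair S a b N

/-- The big image property with base set `Ωbi`. -/
def BigIm (S : Chain Ω) (P : Measure Ω) (Ωbi : Set Ω) : Prop :=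
  0 < P Ωbi ∧ ∀ ω ∈ Ωbi, ∃ I : Finset ℕ,
    (∀ b ∈ I, wordAdm S ω [b]) ∧
    ∀ a : ℕ, wordAdm S (S.θinv ω) [a] → ∃ b ∈ I, wordAdm S (S.θinv ω) [a, b]

/-- The big preimage property with base set `Ωbp`. -/
def BigPre (S : Chain Ω) (P : Measure Ω) (Ωbp : Set Ω) : Prop :=
  0 < P Ωbp ∧ ∀ ω ∈ Ωbp, ∃ I : Finset ℕ,
    (∀ b ∈ I, wordAdm S (S.θinv ω) [b]) ∧
    ∀ a : ℕ, wordAdm S ω [a] → ∃ b ∈ I, wordAdm S (S.θinv ω) [b, a]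

/-- Nonemptiness of `W^n_ω(a, b)`. -/
def WSetNe (S : Chain Ω) (ω : Ω) (n : ℕ) (a b : ℕ) : Prop :=
  ∃ w : List ℕ, w.length = n ∧ w.head? = some a ∧ wordAdm S ω (w ++ [b])

/-- The terms of the random power series `P_ω(s)`. -/
def PserTerm (S : Chain Ω) (φ : Ω → (ℕ → ℕ) → ℝ) (ξ : Ω → ℕ → ℕ)
    (Ωt : Set Ω) (ω : Ω) (s : ℝ) : ℕ → ℝ := fun n =>
  if S.θ^[n] ω ∈ Ωt then s ^ n * preFun S φ ξ ω n else 0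

/-- The random power series `P_ω(s) = ∑_{n ∈ J_ω(Ω̃)} s^n 𝒵^ω_n`. -/
def Pser (S : Chain Ω) (φ : Ω → (ℕ → ℕ) → ℝ) (ξ : Ω → ℕ → ℕ)
    (Ωt : Set Ω) (ω : Ω) (s : ℝ) : ℝ :=
  ∑' n : ℕ, PserTerm S φ ξ Ωt ω s n

/-- `(X, T, φ)` is of divergence type with witness set `Ω̃ = Ωt ⊆ Ω_a`. -/
def DivType (S : Chain Ω) (P : Measure Ω) (φ : Ω → (ℕ → ℕ) → ℝ) (ξ : Ω → ℕ → ℕ)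
    (a : ℕ) (Ωt : Set Ω) : Prop :=
  Ωt ⊆ OmegaW S [a] ∧
    (∀ᵐ ω ∂P, ∀ s : ℝ, 0 < s → s < 1 → Summable (PserTerm S φ ξ Ωt ω s)) ∧
    (∀ᵐ ω ∂P, ¬ Summable (PserTerm S φ ξ Ωt ω 1))

/-- The random measure `μ_{ω,s}`. -/
def muMeas (S : Chain Ω) (φ : Ω → (ℕ → ℕ) → ℝ) (ξ : Ω → ℕ → ℕ)
    (Ωt : Set Ω) (ω : Ω) (s : ℝ) : Measure (ℕ → ℕ) :=
  (ENNReal.ofReal (Pser S φ ξ Ωt ω s))⁻¹ •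
    Measure.sum fun q : ℕ × List ℕ =>
      if S.θ^[q.1] ω ∈ Ωt ∧ q.2.length = q.1 ∧ prepend q.2 (ξ (S.θ^[q.1] ω)) ∈ fiber S ω then
        ENNReal.ofReal (s ^ q.1 * Real.exp (birk S φ ω q.1 (prepend q.2 (ξ (S.θ^[q.1] ω))))) •
          Measure.dirac (prepend q.2 (ξ (S.θ^[q.1] ω)))
      else 0

/-- `Λ_n(ω) = λ(ω) λ(θω) ⋯ λ(θ^{n-1}ω)`. -/
def Lam (S : Chain Ω) (lam : Ω → ℝ) (ω : Ω) (n : ℕ) : ℝ :=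
  ∏ j ∈ Finset.range n, lam (S.θ^[j] ω)

/-- The matrix product `(A^ω A^{θω} ⋯ A^{θ^{n-1}ω})_{ij}`. -/
def matProd (S : Chain Ω) (p : Ω → ℕ → ℕ → ℝ) (ω : Ω) : ℕ → ℕ → ℕ → ℝ
  | 0 => fun i j => if i = j then 1 else 0
  | n + 1 => fun i j => ∑' k : ℕ, matProd S p ω n i k * p (S.θ^[n] ω) k j

/-- The iterated matrix-vector product `(A^{θ^{-n}ω} ⋯ A^{θ^{-1}ω} f)_j`, where
`S.θ` is the inverse `θ^{-1}` of the base map of the original system. -/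
def matVecIt (S : Chain Ω) (p : Ω → ℕ → ℕ → ℝ) (ω : Ω) (f : ℕ → ℝ) : ℕ → ℕ → ℝ
  | 0 => f
  | n + 1 => fun j => ∑' i : ℕ, p (S.θ^[n + 1] ω) j i * matVecIt S p ω f n i


/-- `Conn S n ω a b`: there is an `ω`-admissible path `a = x₀, x₁, …, xₙ = b`. -/
def Conn (S : Chain Ω) : ℕ → Ω → ℕ → ℕ → Prop
  | 0, ω, a, b => S.letterOK ω a = true ∧ a = b
  | n + 1, ω, a, b =>
      S.letterOK ω a = true ∧ ∃ c, S.tr ω a c = true ∧ Conn S n (S.θ ω) c b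

lemma Conn.letterOK_left {S : Chain Ω} {n : ℕ} {ω : Ω} {a b : ℕ} (h : Conn S n ω a b) :
    S.letterOK ω a = true := by
  cases n <;> exact h.1

lemma Conn.trans {S : Chain Ω} {m n : ℕ} {ω : Ω} {a b c : ℕ} (h₁ : Conn S m ω a b)
    (h₂ : Conn S n (S.θ^[m] ω) b c) : Conn S (m + n) ω a c := by
  induction m generalizing ω a with
  | zero =>
    obtain ⟨-, rfl⟩ := h₁
    simpa using h₂
  | succ m ih =>
    obtain ⟨ha, d, hd, h⟩ := h₁
    rw [Nat.succ_add]
    exact ⟨ha, d, hd, ih h h₂⟩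

/-- A path of length `m + n` ends with a path of length `n`. -/
lemma Conn.exists_suffix {S : Chain Ω} {m n : ℕ} {ω : Ω} {a c : ℕ}
    (h : Conn S (m + n) ω a c) : ∃ b, Conn S n (S.θ^[m] ω) b c := by
  induction m generalizing ω a with
  | zero => exact ⟨a, by simpa using h⟩
  | succ m ih =>
    rw [Nat.succ_add] at h
    obtain ⟨-, d, -, h⟩ := h
    exact ih h

/-- Since no row of the transition matrices vanishes, paths can be continued forever. -/
lemma exists_conn (S : Chain Ω) (n : ℕ) {ω : Ω} {a : ℕ} (ha : S.letterOK ω a = true) :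
    ∃ b, S.letterOK (S.θ^[n] ω) b = true ∧ Conn S n ω a b := by
  induction n generalizing ω a with
  | zero => exact ⟨a, ha, ha, rfl⟩
  | succ n ih =>
    obtain ⟨c, hc, hac⟩ := S.no_zero_row ω a ha
    obtain ⟨b, hb, h⟩ := ih hc
    exact ⟨b, hb, ha, c, hac, h⟩

lemma conn_of_mem_fiber {S : Chain Ω} {ω : Ω} {x : ℕ → ℕ} (hx : x ∈ fiber S ω) (n : ℕ) :
    Conn S n ω (x 0) (x n) := by
  induction n generalizing ω x with
  | zero => exact ⟨(hx 0).1, rfl⟩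
  | succ n ih => exact ⟨(hx 0).1, x 1, (hx 0).2, ih (x := shift x) fun k => hx (k + 1)⟩

lemma wordAdm_singleton {S : Chain Ω} {ω : Ω} {a : ℕ} :
    wordAdm S ω [a] ↔ S.letterOK ω a = true := by
  simp [wordAdm]

lemma wordAdm_cons_cons {S : Chain Ω} {ω : Ω} {a b : ℕ} {w : List ℕ} :
    wordAdm S ω (a :: b :: w) ↔
      S.letterOK ω a = true ∧ S.tr ω a b = true ∧ wordAdm S (S.θ ω) (b :: w) := by
  constructor
  · rintro ⟨h₁, h₂⟩
    refine ⟨h₁ 0 (by simp), h₂ 0 (by simp), fun i hi => ?_, fun i hi => ?_⟩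
    · exact h₁ (i + 1) (by simpa using hi)
    · exact h₂ (i + 1) (by simpa using hi)
  · rintro ⟨ha, hab, h₁, h₂⟩
    refine ⟨fun i hi => ?_, fun i hi => ?_⟩
    · cases i with
      | zero => exact ha
      | succ i => exact h₁ i (by simpa using hi)
    · cases i with
      | zero => exact hab
      | succ i => exact h₂ i (by simpa using hi)

lemma conn_one_of_wordAdm {S : Chain Ω} {ω : Ω} {a b : ℕ} (h : wordAdm S ω [a, b]) :
    Conn S 1 ω a b := by
  rw [wordAdm_cons_cons, wordAdm_singleton] at h
  exact ⟨h.1, b, h.2.1, h.2.2, rfl⟩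

lemma Conn.exists_wordAdm {S : Chain Ω} {n : ℕ} {ω : Ω} {a b : ℕ} (h : Conn S n ω a b) :
    ∃ w : List ℕ, w.length = n ∧ (w ++ [b]).head? = some a ∧ wordAdm S ω (w ++ [b]) := by
  induction n generalizing ω a with
  | zero =>
    obtain ⟨ha, rfl⟩ := h
    exact ⟨[], rfl, rfl, wordAdm_singleton.2 ha⟩
  | succ n ih =>
    obtain ⟨ha, c, hac, h⟩ := h
    obtain ⟨w, hw, hc, hadm⟩ := ih h
    refine ⟨a :: w, by simp [hw], rfl, ?_⟩
    obtain ⟨v, hv⟩ : ∃ v, w ++ [b] = c :: v := List.head?_eq_some_iff.1 hc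
    rw [List.cons_append, hv, wordAdm_cons_cons]
    exact ⟨ha, hac, hv ▸ hadm⟩

lemma Conn.wSetNe {S : Chain Ω} {n : ℕ} {ω : Ω} {a b : ℕ} (h : Conn S n ω a b)
    (hn : 0 < n) : WSetNe S ω n a b := by
  obtain ⟨w, hw, ha, hadm⟩ := h.exists_wordAdm
  refine ⟨w, hw, ?_, hadm⟩
  cases w with
  | nil => simp at hw; omega
  | cons c w => simpa using ha

lemma mem_OmegaW_singleton {S : Chain Ω} {ω : Ω} {a : ℕ} :
    ω ∈ OmegaW S [a] ↔ S.letterOK ω a = true := by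
  constructor
  · rintro ⟨x, hx, h⟩
    have h0 : x 0 = a := h 0 (by simp)
    exact h0 ▸ (hx 0).1
  · intro ha
    have step : ∀ (n : ℕ) (i : {i // S.letterOK (S.θ^[n] ω) i = true}),
        ∃ j : {j // S.letterOK (S.θ^[n + 1] ω) j = true}, S.tr (S.θ^[n] ω) i j = true := by
      rintro n ⟨i, hi⟩
      obtain ⟨j, hj, hij⟩ := S.no_zero_row _ i hi
      exact ⟨⟨j, by rwa [Function.iterate_succ_apply']⟩, hij⟩
    choose f hf using step
    let x : ∀ n, {i // S.letterOK (S.θ^[n] ω) i = true} := fun n =>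
      Nat.rec (motive := fun n => {i // S.letterOK (S.θ^[n] ω) i = true}) ⟨a, ha⟩ f n
    refine ⟨fun n => x n, fun n => ⟨(x n).2, hf n (x n)⟩, fun i hi => ?_⟩
    have hi0 : i = 0 := by simpa using hi
    subst hi0
    rfl

lemma measurableSet_letterOK (S : Chain Ω) (a : ℕ) :
    MeasurableSet {ω | S.letterOK ω a = true} :=
  measurableSet_eq_fun (S.letterOK_meas a) measurable_const

lemma measurableSet_wordAdm_pair (S : Chain Ω) (a b : ℕ) :
    MeasurableSet {ω | wordAdm S ω [a, b]} := by
  simp only [wordAdm_cons_cons, wordAdm_singleton]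
  exact (measurableSet_letterOK S a).inter
    ((measurableSet_eq_fun (S.tr_meas a b) measurable_const).inter
      (S.θ_meas (measurableSet_letterOK S b)))

lemma iterate_θ_θinv (S : Chain Ω) (k m : ℕ) (ω : Ω) :
    S.θ^[k] (S.θinv^[k + m] ω) = S.θinv^[m] ω := by
  rw [Function.iterate_add_apply]
  exact (S.θ_right_inv.iterate k) _

lemma iterate_θinv_θ (S : Chain Ω) (k : ℕ) (ω : Ω) : S.θinv^[k] (S.θ^[k] ω) = ω :=
  (S.θ_left_inv.iterate k) _

lemma ergodic_θinv {S : Chain Ω} {P : Measure Ω} (hθ : Ergodic S.θ P) : Ergodic S.θinv P := by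
  let e : Ω ≃ᵐ Ω :=
    { toFun := S.θ
      invFun := S.θinv
      left_inv := S.θ_left_inv
      right_inv := S.θ_right_inv
      measurable_toFun := S.θ_meas
      measurable_invFun := S.θinv_meas }
  have hmp : MeasurePreserving S.θinv P P :=
    MeasurePreserving.symm e hθ.toMeasurePreserving
  refine ⟨hmp, ⟨fun s hs hinv => hθ.aeconst_set hs ?_⟩⟩
  conv_lhs => rw [← hinv]
  rw [← Set.preimage_comp, S.θ_left_inv.comp_eq_id, Set.preimage_id]

lemma ae_forall_iterate {P : Measure Ω} {T : Ω → Ω} (hT : MeasurePreserving T P P)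
    {p : Ω → Prop} (hp : ∀ᵐ ω ∂P, p ω) : ∀ᵐ ω ∂P, ∀ n, p (T^[n] ω) :=
  ae_all_iff.2 fun n => (hT.iterate n).quasiMeasurePreserving.ae hp

/-- Almost every orbit of an ergodic map visits a set of positive measure infinitely often. -/
lemma ae_frequently_mem {P : Measure Ω} [IsProbabilityMeasure P] {T : Ω → Ω}
    (hT : Ergodic T P) {G : Set Ω} (hG : MeasurableSet G) (hpos : P G ≠ 0) :
    ∀ᵐ ω ∂P, ∃ᶠ n in atTop, T^[n] ω ∈ G := by
  have hmeas : MeasurableSet {ω | ∃ᶠ n in atTop, T^[n] ω ∈ G} := by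
    simp only [frequently_atTop, ← exists_prop, Set.ofPred_forall, Set.ofPred_exists]
    exact .iInter fun m => .iUnion fun n => .iUnion fun _ => hT.measurable.iterate n hG
  have hinv : T ⁻¹' {ω | ∃ᶠ n in atTop, T^[n] ω ∈ G} = {ω | ∃ᶠ n in atTop, T^[n] ω ∈ G} := by
    ext ω
    change (∃ᶠ n in atTop, T^[n + 1] ω ∈ G) ↔ ∃ᶠ n in atTop, T^[n] ω ∈ G
    conv_rhs => rw [← map_add_atTop_eq_nat 1, frequently_map]
  refine (hT.ae_mem_or_ae_notMem hmeas hinv).resolve_right fun h => hpos ?_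
  rw [measure_eq_zero_iff_ae_notMem]
  filter_upwards [h, hT.toMeasurePreserving.conservative.ae_mem_imp_frequently_image_mem
    hG.nullMeasurableSet] with ω hω hrec hωG
  exact hω (hrec hωG)

/-- The visits of `ae_frequently_mem` can be chosen after a random delay that is evaluated at the
visited point. -/
lemma ae_frequently_mem_and_le {P : Measure Ω} [IsProbabilityMeasure P] {T : Ω → Ω}
    (hT : Ergodic T P) {G : Set Ω} (hG : MeasurableSet G) (hpos : P G ≠ 0)
    {N : Ω → ℕ} (hN : Measurable N) :
    ∀ᵐ ω ∂P, ∃ᶠ n in atTop, T^[n] ω ∈ G ∧ N (T^[n] ω) ≤ n := by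
  obtain ⟨K, hK⟩ : ∃ K, P (G ∩ {ω | N ω ≤ K}) ≠ 0 := by
    by_contra! h
    refine hpos (measure_mono_null (fun ω hω => ?_) (measure_iUnion_null h))
    exact Set.mem_iUnion.2 ⟨N ω, hω, le_refl (N ω)⟩
  have hmeas : MeasurableSet {ω | N ω ≤ K} := measurableSet_le hN measurable_const
  filter_upwards [ae_frequently_mem hT (hG.inter hmeas) hK] with ω hω
  exact (hω.and_eventually (eventually_ge_atTop K)).mono fun n hn => ⟨hn.1.1, hn.1.2.trans hn.2⟩

/-- Topological mixing in terms of paths; letters of probability zero are never met. -/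
lemma exists_mixing_time {S : Chain Ω} {P : Measure Ω} (hθ : MeasurePreserving S.θ P P)
    (hmix : TopMix S P) (a b : ℕ) :
    ∃ N : Ω → ℕ, Measurable N ∧ ∀ᵐ ω ∂P, ∀ n, N ω ≤ n → S.letterOK ω a = true →
      S.letterOK (S.θ^[n] ω) b = true → Conn S n ω a b := by
  have hnull : ∀ c, ¬ 0 < P (OmegaW S [c]) → ∀ᵐ ω ∂P, ¬ S.letterOK ω c = true := by
    intro c hc
    have h0 : P (OmegaW S [c]) = 0 := by simpa using hc
    filter_upwards [measure_eq_zero_iff_ae_notMem.1 h0] with ω hω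
    rwa [← mem_OmegaW_singleton]
  by_cases ha : 0 < P (OmegaW S [a])
  · by_cases hb : 0 < P (OmegaW S [b])
    · obtain ⟨N, hN, h⟩ := hmix a b ha hb
      refine ⟨N, hN, ae_of_all _ fun ω n hn hωa hωb => ?_⟩
      obtain ⟨x, hx, hy⟩ :=
        h ω n hn (wordAdm_singleton.2 hωa) (mem_OmegaW_singleton.2 hωb)
      have h0 : x 0 = a := hx.2 0 (by simp)
      have hn : x n = b := by simpa [shiftIt] using hy.2 0 (by simp)
      exact h0 ▸ hn ▸ conn_of_mem_fiber hx.1 n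
    · refine ⟨0, measurable_const, ?_⟩
      filter_upwards [ae_forall_iterate hθ (hnull b hb)] with ω hω n _ _ h
      exact absurd h (hω n)
  · refine ⟨0, measurable_const, ?_⟩
    filter_upwards [hnull a ha] with ω hω n _ h
    exact absurd h hω

/-- Almost surely every available letter is the endpoint of paths of every length. -/
lemma ae_exists_conn_to {S : Chain Ω} {P : Measure Ω} [IsProbabilityMeasure P]
    (hθ : Ergodic S.θ P) (hmix : TopMix S P) {a : ℕ} (ha : P (OmegaW S [a]) ≠ 0) :
    ∀ᵐ ω ∂P, ∀ k c, S.letterOK (S.θ^[k] ω) c = true → ∃ d, Conn S k ω d c := by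
  have hθinv := ergodic_θinv hθ
  have ha' : P {ω | S.letterOK ω a = true} ≠ 0 := by
    rwa [← show OmegaW S [a] = {ω | S.letterOK ω a = true} from
      Set.ext fun _ => mem_OmegaW_singleton]
  have past : ∀ᵐ ω ∂P, ∀ c, S.letterOK ω c = true →
      ∀ k, ∃ d, Conn S k (S.θinv^[k] ω) d c := by
    refine ae_all_iff.2 fun c => ?_
    obtain ⟨N, hN, h⟩ := exists_mixing_time hθ.toMeasurePreserving hmix a c
    filter_upwards [ae_frequently_mem_and_le hθinv (measurableSet_letterOK S a) ha' hN,
      ae_forall_iterate hθinv.toMeasurePreserving h] with ω hfreq hω hc k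
    obtain ⟨m, hkm, hma, hmN⟩ := frequently_atTop.1 hfreq k
    obtain ⟨j, rfl⟩ := Nat.exists_eq_add_of_le' hkm
    have hconn := hω (j + k) (j + k) hmN hma
      (by simpa using (congrArg (S.letterOK · c) (iterate_θ_θinv S (j + k) 0 ω)).trans hc)
    simpa only [iterate_θ_θinv] using hconn.exists_suffix
  filter_upwards [ae_forall_iterate hθ.toMeasurePreserving past] with ω hω k c hc
  simpa only [iterate_θinv_θ] using hω k c hc k

/-- Points whose letters all have a predecessor in the finite set `I`. -/
def preimageSet (S : Chain Ω) (I : Finset ℕ) : Set Ω :=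
  {ω | ∀ c, S.letterOK ω c = true → ∃ b ∈ I, wordAdm S (S.θinv ω) [b, c]}

/-- Points such that all letters of the preceding fiber have a successor in the finite set `I`. -/
def imageSet (S : Chain Ω) (I : Finset ℕ) : Set Ω :=
  {ω | ∀ c, S.letterOK (S.θinv ω) c = true → ∃ b ∈ I, wordAdm S (S.θinv ω) [c, b]}

lemma measurableSet_preimageSet (S : Chain Ω) (I : Finset ℕ) :
    MeasurableSet (preimageSet S I) := by
  simp only [preimageSet, Set.ofPred_forall, imp_iff_not_or, Set.ofPred_or, Set.ofPred_exists,
    ← exists_prop]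
  exact .iInter fun c => (measurableSet_letterOK S c).compl.union
    (.iUnion fun b => .iUnion fun _ => S.θinv_meas (measurableSet_wordAdm_pair S b c))

lemma measurableSet_imageSet (S : Chain Ω) (I : Finset ℕ) : MeasurableSet (imageSet S I) := by
  simp only [imageSet, Set.ofPred_forall, imp_iff_not_or, Set.ofPred_or, Set.ofPred_exists,
    ← exists_prop]
  exact .iInter fun c => (S.θinv_meas (measurableSet_letterOK S c)).compl.union
    (.iUnion fun b => .iUnion fun _ => S.θinv_meas (measurableSet_wordAdm_pair S c b))

lemma exists_ne_zero_of_subset_iUnion {P : Measure Ω} {E : Set Ω} (hE : 0 < P E)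
    {G : Finset ℕ → Set Ω} (h : ∀ ω ∈ E, ∃ I, ω ∈ G I) : ∃ I, P (G I) ≠ 0 := by
  by_contra! h0
  exact hE.ne' (measure_mono_null (fun ω hω => Set.mem_iUnion.2 (h ω hω))
    (measure_iUnion_null h0))

lemma BigPre.exists_preimageSet {S : Chain Ω} {P : Measure Ω} {E : Set Ω}
    (h : BigPre S P E) : ∃ I, P (preimageSet S I) ≠ 0 :=
  exists_ne_zero_of_subset_iUnion h.1 fun ω hω =>
    let ⟨I, _, hI⟩ := h.2 ω hω
    ⟨I, fun c hc => hI c (wordAdm_singleton.2 hc)⟩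

lemma BigIm.exists_imageSet {S : Chain Ω} {P : Measure Ω} {E : Set Ω}
    (h : BigIm S P E) : ∃ I, P (imageSet S I) ≠ 0 :=
  exists_ne_zero_of_subset_iUnion h.1 fun ω hω =>
    let ⟨I, _, hI⟩ := h.2 ω hω
    ⟨I, fun c hc => hI c (wordAdm_singleton.2 hc)⟩

/-- Under the big preimage property, a letter eventually reaches all letters. -/
lemma BigPre.ae_conn_from {S : Chain Ω} {P : Measure Ω} [IsProbabilityMeasure P]
    {E : Set Ω} (hbp : BigPre S P E) (hθ : Ergodic S.θ P) (hmix : TopMix S P) {a : ℕ}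
    (ha : P (OmegaW S [a]) ≠ 0) :
    ∀ᵐ ω ∂P, S.letterOK ω a = true → ∃ α, ∀ n, α ≤ n → ∀ b,
      S.letterOK (S.θ^[n] ω) b = true → Conn S n ω a b := by
  obtain ⟨I, hI⟩ := hbp.exists_preimageSet
  choose N _ hN using exists_mixing_time hθ.toMeasurePreserving hmix a
  filter_upwards [ae_frequently_mem hθ (measurableSet_preimageSet S I) hI, ae_all_iff.2 hN,
    ae_forall_iterate hθ.toMeasurePreserving (ae_exists_conn_to hθ hmix ha)]
    with ω hfreq hmixω hback haω
  obtain ⟨m, hm, hmI⟩ := frequently_atTop.1 hfreq ((∑ d ∈ I, N d ω) + 1)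
  obtain ⟨j, rfl⟩ : ∃ j, m = j + 1 := ⟨m - 1, by omega⟩
  have hall : ∀ c, S.letterOK (S.θ^[j + 1] ω) c = true → Conn S (j + 1) ω a c := by
    intro c hc
    obtain ⟨b, hb, hbc⟩ := hmI c hc
    rw [Function.iterate_succ_apply', S.θ_left_inv] at hbc
    have hbc' := conn_one_of_wordAdm hbc
    have hNb : N b ω ≤ ∑ d ∈ I, N d ω :=
      Finset.single_le_sum (f := fun d => N d ω) (fun _ _ => Nat.zero_le _) hb
    exact (hmixω b j (by omega) haω hbc'.letterOK_left).trans hbc'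
  refine ⟨j + 1, fun n hn b hb => ?_⟩
  obtain ⟨k, rfl⟩ := Nat.exists_eq_add_of_le hn
  obtain ⟨d, hd⟩ := hback (j + 1) k b
    (by rwa [← Function.iterate_add_apply, Nat.add_comm k])
  exact (hall d hd.letterOK_left).trans hd

/-- Under the big image property, a letter is reached from all letters of the remote past. -/
lemma BigIm.ae_conn_to {S : Chain Ω} {P : Measure Ω} [IsProbabilityMeasure P]
    {E : Set Ω} (hbi : BigIm S P E) (hθ : Ergodic S.θ P) (hmix : TopMix S P) (a : ℕ) :
    ∀ᵐ ω ∂P, S.letterOK ω a = true → ∃ β, 0 < β ∧ ∀ n, β ≤ n → ∀ b,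
      S.letterOK (S.θinv^[n] ω) b = true → Conn S n (S.θinv^[n] ω) b a := by
  have hθinv := ergodic_θinv hθ
  obtain ⟨I, hI⟩ := hbi.exists_imageSet
  choose N hNmeas hN using fun d => exists_mixing_time hθ.toMeasurePreserving hmix d a
  have hsum : Measurable fun ω => ∑ d ∈ I, N d ω :=
    Finset.measurable_sum _ fun d _ => hNmeas d
  filter_upwards [ae_frequently_mem_and_le hθinv (measurableSet_imageSet S I) hI hsum,
    ae_forall_iterate hθinv.toMeasurePreserving (ae_all_iff.2 hN)] with ω hfreq hmixω haω
  obtain ⟨m, hmI, hm⟩ := hfreq.exists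
  have hall : ∀ c, S.letterOK (S.θinv^[m + 1] ω) c = true →
      Conn S (1 + m) (S.θinv^[m + 1] ω) c a := by
    intro c hc
    rw [Function.iterate_succ_apply'] at hc ⊢
    obtain ⟨b, hb, hcb⟩ := hmI c hc
    have hNb : N b (S.θinv^[m] ω) ≤ ∑ d ∈ I, N d (S.θinv^[m] ω) :=
      Finset.single_le_sum (f := fun d => N d (S.θinv^[m] ω)) (fun _ _ => Nat.zero_le _) hb
    have hbω : S.letterOK (S.θinv^[m] ω) b = true := by
      rw [wordAdm_cons_cons, wordAdm_singleton, S.θ_right_inv] at hcb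
      exact hcb.2.2
    refine (conn_one_of_wordAdm hcb).trans ?_
    rw [Function.iterate_one, S.θ_right_inv]
    refine hmixω m b m (hNb.trans hm) hbω ?_
    rwa [show S.θ^[m] (S.θinv^[m] ω) = ω from iterate_θ_θinv S m 0 ω]
  refine ⟨m + 1, m.succ_pos, fun n hn b hb => ?_⟩
  obtain ⟨k, rfl⟩ := Nat.exists_eq_add_of_le' hn
  obtain ⟨c, hc, hbc⟩ := exists_conn S k hb
  rw [iterate_θ_θinv] at hc
  have h := hbc.trans (n := 1 + m) (c := a) (by rw [iterate_θ_θinv]; exact hall c hc)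
  rwa [Nat.add_comm 1 m] at h

/-- Lemma 3.2: under the b.i.p.-property, for every `a ∈ W^1` and
a.e. `ω ∈ Ω_a` there are thresholds `α_ω, β_ω` such that `W^n_ω(a,b) ≠ ∅` for
`n ≥ α_ω` and `W^n_{θ^{-n}ω}(b,a) ≠ ∅` for `n ≥ β_ω`. -/
theorem bip_eventually_connects
    {Ω : Type*} [MeasurableSpace Ω] (P : Measure Ω) [IsProbabilityMeasure P]
    (S : Chain Ω) (hθ : Ergodic S.θ P)
    (hmix : TopMix S P)
    (Ωbi Ωbp : Set Ω) (hbi : BigIm S P Ωbi) (hbp : BigPre S P Ωbp)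
    (a : ℕ) (ha : 0 < P (OmegaW S [a])) :
    ∀ᵐ ω ∂P, ω ∈ OmegaW S [a] → ∃ α β : ℕ,
      (∀ n : ℕ, α ≤ n → ∀ b : ℕ, wordAdm S (S.θ^[n] ω) [b] → WSetNe S ω n a b) ∧
      (∀ n : ℕ, β ≤ n → ∀ b : ℕ, wordAdm S (S.θinv^[n] ω) [b] →
        WSetNe S (S.θinv^[n] ω) n b a) := by
  filter_upwards [hbp.ae_conn_from hθ hmix ha.ne', hbi.ae_conn_to hθ hmix a] with ω hfrom hto hω
  rw [mem_OmegaW_singleton] at hω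
  obtain ⟨α, hα⟩ := hfrom hω
  obtain ⟨β, hβ0, hβ⟩ := hto hω
  refine ⟨α + 1, β, fun n hn b hb => ?_, fun n hn b hb => ?_⟩
  · exact (hα n (by omega) b (wordAdm_singleton.1 hb)).wSetNe (by omega)
  · exact (hβ n hn b (wordAdm_singleton.1 hb)).wSetNe (by omega)

end RandomTMC
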